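/- Let (L₁, ∘¹_λ, [·_λ ·]¹) and (L₂, ∘²_λ, [·_λ ·]²) be transposed Poisson conformal superalgebras. Let L = L₁ ⊗_{ℂ[∂]} L₂ with ℤ₂-grading |a₁ ⊗ a₂| = |a₁| + |a₂| and ℂ[∂]-module structure ∂(a ⊗ b) = (∂a) ⊗ b = a ⊗ (∂b). Define, for homogeneous a₁, b₁ ∈ L₁ and a₂, b₂ ∈ L₂: (a₁ ⊗ a₂) ∘_λ (b₁ ⊗ b₂) = (−1)^{|a₂||b₁|} (a₁ ∘¹_λ b₁) ⊗ (a₂ ∘²_λ b₂), and [(a₁ ⊗ a₂)_λ (b₁ ⊗ b₂)] = (−1)^{|a₂||b₁|} ( [a₁_λ b₁]¹ ⊗ (a₂ ∘²_λ b₂) + (a₁ ∘¹_λ b₁) ⊗ [a₂_λ b₂]² ). Then (L, ∘_λ, [·_λ ·]) is a transposed Poisson conformal superalgebra. -/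

import Mathlib

open Polynomial
open scoped TensorProduct

noncomputable section

namespace TPCSAFormal

/-- The super-sign `(-1)^{i·j}` for parities `i, j ∈ ℤ/2ℤ`. -/
def sgn (i j : ZMod 2) : ℂ := (-1 : ℂ) ^ (i.val * j.val)

variable (L : Type*) [AddCommGroup L] [Module ℂ L]
  [Module (Polynomial ℂ) L] [IsScalarTower ℂ (Polynomial ℂ) L]

/-- A conformal `λ`-product on the `ℂ[∂]`-module `L`, recorded by its family of `n`-th
product coefficients: `a ∘_λ b = ∑_n λ^n • coeff n a b`, with finitely many nonzero terms.
This is exactly the data of a `ℂ`-bilinear map `L ⊗ L → ℂ[λ] ⊗ L`. -/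
structure ConformalProduct where
  coeff : ℕ → L →ₗ[ℂ] L →ₗ[ℂ] L
  coeff_finite : ∀ a b : L, ∃ N : ℕ, ∀ n : ℕ, N ≤ n → coeff n a b = 0

variable {L}

/-- The value `a ∘_λ b` of the `λ`-product at `λ ∈ ℂ`.  Since `ℂ` is infinite, identities
between such values for all `λ` are equivalent to the corresponding polynomial identities. -/
def ConformalProduct.mul (m : ConformalProduct L) (lam : ℂ) (a b : L) : L :=
  ∑ᶠ n : ℕ, lam ^ n • m.coeff n a b

/-- The value `a ∘_{-∂-λ} b`, where `∂` acts on `L` as scalar multiplication by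
`X ∈ ℂ[∂]` (the variable `λ` being replaced by the operator `-∂-λ`). -/
def ConformalProduct.cmul (m : ConformalProduct L) (lam : ℂ) (a b : L) : L :=
  ∑ᶠ n : ℕ, ((-((X : Polynomial ℂ) + C lam)) ^ n) • m.coeff n a b

variable (L) in
/-- A `ℤ₂`-grading on `L` making it a `ℤ₂`-graded `ℂ[∂]`-module: `L = L₀ ⊕ L₁` with
`∂ L_i ⊆ L_i`, where `∂` acts as multiplication by `X ∈ ℂ[∂]`. -/
structure SuperModule where
  grade : ZMod 2 → Submodule ℂ L
  isInternal : DirectSum.IsInternal grade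
  X_smul_mem : ∀ (i : ZMod 2) (a : L), a ∈ grade i → (X : Polynomial ℂ) • a ∈ grade i

/-- `m` is an even `λ`-product on the `ℤ₂`-graded `ℂ[∂]`-module `(L, S)`:
it is even with respect to the grading and conformally sesquilinear. -/
structure IsLambdaProduct (S : SuperModule L) (m : ConformalProduct L) : Prop where
  even : ∀ (i j : ZMod 2) (a b : L), a ∈ S.grade i → b ∈ S.grade j →
    ∀ n : ℕ, m.coeff n a b ∈ S.grade (i + j)
  sesq_left : ∀ (lam : ℂ) (a b : L),
    m.mul lam ((X : Polynomial ℂ) • a) b = (-lam) • m.mul lam a b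
  sesq_right : ∀ (lam : ℂ) (a b : L),
    m.mul lam a ((X : Polynomial ℂ) • b) =
      (X : Polynomial ℂ) • m.mul lam a b + lam • m.mul lam a b

/-- `(L, S, m)` is a commutative associative conformal superalgebra. -/
structure IsCommAssoc (S : SuperModule L) (m : ConformalProduct L)
    extends IsLambdaProduct S m : Prop where
  comm : ∀ (i j : ZMod 2) (a b : L), a ∈ S.grade i → b ∈ S.grade j →
    ∀ lam : ℂ, m.mul lam a b = sgn i j • m.cmul lam b a
  assoc : ∀ (lam mu : ℂ) (a b c : L),
    m.mul lam a (m.mul mu b c) = m.mul (lam + mu) (m.mul lam a b) c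

/-- `(L, S, br)` is a Lie conformal superalgebra. -/
structure IsLie (S : SuperModule L) (br : ConformalProduct L)
    extends IsLambdaProduct S br : Prop where
  skew : ∀ (i j : ZMod 2) (a b : L), a ∈ S.grade i → b ∈ S.grade j →
    ∀ lam : ℂ, br.mul lam a b = -(sgn i j • br.cmul lam b a)
  jacobi : ∀ (i j : ZMod 2) (a b : L), a ∈ S.grade i → b ∈ S.grade j →
    ∀ (c : L) (lam mu : ℂ),
      br.mul lam a (br.mul mu b c) =
        br.mul (lam + mu) (br.mul lam a b) c + sgn i j • br.mul mu b (br.mul lam a c)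

/-- `(L, S, m, br)` is a transposed Poisson conformal superalgebra. -/
structure IsTPCSA (S : SuperModule L) (m br : ConformalProduct L) : Prop where
  commAssoc : IsCommAssoc S m
  lie : IsLie S br
  transposedLeibniz : ∀ (i j : ZMod 2) (a b : L), a ∈ S.grade i → b ∈ S.grade j →
    ∀ (c : L) (lam mu : ℂ),
      (2 : ℂ) • m.mul lam a (br.mul mu b c) =
        br.mul (lam + mu) (m.mul lam a b) c + sgn i j • br.mul mu b (m.mul lam a c)

/-- `(L, S, m, br)` is a Poisson conformal superalgebra. -/
structure IsPCSA (S : SuperModule L) (m br : ConformalProduct L) : Prop where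
  commAssoc : IsCommAssoc S m
  lie : IsLie S br
  leibniz : ∀ (i j : ZMod 2) (a b : L), a ∈ S.grade i → b ∈ S.grade j →
    ∀ (c : L) (lam mu : ℂ),
      br.mul lam a (m.mul mu b c) =
        m.mul (lam + mu) (br.mul lam a b) c + sgn i j • m.mul mu b (br.mul lam a c)

/-- `(L, S, br, α)` is a Hom-Lie conformal superalgebra. -/
structure IsHomLie (S : SuperModule L) (br : ConformalProduct L) (α : L → L)
    extends IsLambdaProduct S br : Prop where
  map_smul_add : ∀ (c : ℂ) (a b : L), α (c • a + b) = c • α a + α b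
  map_grade : ∀ (i : ZMod 2) (a : L), a ∈ S.grade i → α a ∈ S.grade i
  commute_partial : ∀ a : L, α ((X : Polynomial ℂ) • a) = (X : Polynomial ℂ) • α a
  skew : ∀ (i j : ZMod 2) (a b : L), a ∈ S.grade i → b ∈ S.grade j →
    ∀ lam : ℂ, br.mul lam a b = -(sgn i j • br.cmul lam b a)
  homJacobi : ∀ (i j : ZMod 2) (a b : L), a ∈ S.grade i → b ∈ S.grade j →
    ∀ (c : L) (lam mu : ℂ),
      br.mul lam (α a) (br.mul mu b c) =
        br.mul (lam + mu) (br.mul lam a b) (α c) + sgn i j • br.mul mu (α b) (br.mul lam a c)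

/-- `(L, S, p)` is a left-symmetric conformal superalgebra. -/
structure IsLeftSymmetric (S : SuperModule L) (p : ConformalProduct L)
    extends IsLambdaProduct S p : Prop where
  leftSym : ∀ (i j : ZMod 2) (a b : L), a ∈ S.grade i → b ∈ S.grade j →
    ∀ (c : L) (lam mu : ℂ),
      p.mul (lam + mu) (p.mul lam a b) c - p.mul lam a (p.mul mu b c) =
        sgn i j • (p.mul (lam + mu) (p.mul mu b a) c - p.mul mu b (p.mul lam a c))

/-- `(L, S, p)` is a (left) Novikov conformal superalgebra. -/
structure IsNovikov (S : SuperModule L) (p : ConformalProduct L)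
    extends IsLeftSymmetric S p : Prop where
  novikov : ∀ (j k : ZMod 2) (b c : L), b ∈ S.grade j → c ∈ S.grade k →
    ∀ (a : L) (lam mu : ℂ),
      p.mul (lam + mu) (p.mul lam a b) c = sgn j k • p.cmul mu (p.mul lam a c) b

/-- `(L, S, mc, p)` is a Novikov-Poisson conformal superalgebra. -/
structure IsNovikovPoisson (S : SuperModule L) (mc p : ConformalProduct L) : Prop where
  commAssoc : IsCommAssoc S mc
  novikov : IsNovikov S p
  compat₁ : ∀ (lam mu : ℂ) (a b c : L),
    p.mul (lam + mu) (mc.mul lam a b) c = mc.mul lam a (p.mul mu b c)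
  compat₂ : ∀ (i j : ZMod 2) (a b : L), a ∈ S.grade i → b ∈ S.grade j →
    ∀ (c : L) (lam mu : ℂ),
      mc.mul (lam + mu) (p.mul lam a b) c - p.mul lam a (mc.mul mu b c) =
        sgn i j • (mc.mul (lam + mu) (p.mul mu b a) c - p.mul mu b (mc.mul lam a c))

/-- `(L, S, mc, p)` is a pre-Lie commutative conformal superalgebra. -/
structure IsPreLieComm (S : SuperModule L) (mc p : ConformalProduct L) : Prop where
  commAssoc : IsCommAssoc S mc
  leftSymmetric : IsLeftSymmetric S p
  compat : ∀ (i j : ZMod 2) (a b : L), a ∈ S.grade i → b ∈ S.grade j →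
    ∀ (c : L) (lam mu : ℂ),
      p.mul lam a (mc.mul mu b c) =
        mc.mul (lam + mu) (p.mul lam a b) c + sgn i j • mc.mul mu b (p.mul lam a c)

/-- `(L, S, mc, p)` is a pre-Lie Poisson conformal superalgebra. -/
structure IsPreLiePoisson (S : SuperModule L) (mc p : ConformalProduct L) : Prop where
  commAssoc : IsCommAssoc S mc
  leftSymmetric : IsLeftSymmetric S p
  compat₁ : ∀ (lam mu : ℂ) (a b c : L),
    p.mul (lam + mu) (mc.mul lam a b) c = mc.mul lam a (p.mul mu b c)
  compat₂ : ∀ (i j : ZMod 2) (a b : L), a ∈ S.grade i → b ∈ S.grade j →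
    ∀ (c : L) (lam mu : ℂ),
      mc.mul (lam + mu) (p.mul lam a b) c - p.mul lam a (mc.mul mu b c) =
        sgn i j • (mc.mul (lam + mu) (p.mul mu b a) c - p.mul mu b (mc.mul lam a c))


section PolyFun

variable {M : Type*} [AddCommGroup M] [Module ℂ M] [Module ℂ[X] M] [IsScalarTower ℂ ℂ[X] M]

/-- Evaluation `∑ rⁿ • vₙ` of a polynomial with coefficients in `M` at a variable `r ∈ ℂ[∂]`. -/
def polyEval : (ℕ →₀ M) →ₗ[ℂ] (ℂ[X] → M) :=
  LinearMap.pi fun r => Finsupp.lsum ℂ fun n => Algebra.lsmul ℂ ℂ M (r ^ n)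

theorem polyEval_apply (v : ℕ →₀ M) (r : ℂ[X]) :
    polyEval v r = v.sum fun n x => r ^ n • x := rfl

@[simp]
theorem polyEval_single (n : ℕ) (x : M) (r : ℂ[X]) :
    polyEval (Finsupp.single n x) r = r ^ n • x := by
  simp [polyEval_apply]

theorem C_smul_eq (c : ℂ) (x : M) : (C c : ℂ[X]) • x = c • x :=
  algebraMap_smul ℂ[X] c x

theorem coeff_mem_of_polyEval_mem (W : Submodule ℂ M) (v : ℕ →₀ M)
    (h : ∀ c : ℂ, polyEval v (C c) ∈ W) (n : ℕ) : v n ∈ W := by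
  by_contra hn
  obtain ⟨f, hf, hW⟩ := Submodule.exists_le_ker_of_notMem hn
  have hp : (∑ k ∈ v.support, monomial k (f (v k)) : ℂ[X]) = 0 := by
    refine Polynomial.funext fun c => ?_
    have := LinearMap.mem_ker.1 (hW (h c))
    rw [polyEval_apply, Finsupp.sum, map_sum] at this
    rw [eval_finsetSum, eval_zero, ← this]
    refine Finset.sum_congr rfl fun k _ => ?_
    rw [eval_monomial, ← C_pow, C_smul_eq, map_smul, smul_eq_mul, mul_comm]
  have hc := congrArg (fun p : ℂ[X] => p.coeff n) hp
  simp only [finsetSum_coeff, coeff_monomial, Finset.sum_ite_eq', coeff_zero] at hc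
  split_ifs at hc with hs
  · exact hf hc
  · exact hf (by rw [Finsupp.notMem_support_iff.1 hs, map_zero])

variable (M) in
/-- Functions of a variable in `ℂ[∂]` that are polynomial with coefficients in `M`. -/
def polyFun : Submodule ℂ (ℂ[X] → M) := LinearMap.range polyEval

theorem polyEval_mem (v : ℕ →₀ M) : polyEval v ∈ polyFun M := ⟨v, rfl⟩

theorem monomial_mem_polyFun (n : ℕ) (x : M) : (fun r : ℂ[X] => r ^ n • x) ∈ polyFun M :=
  ⟨Finsupp.single n x, by ext r; simp⟩

theorem polyFun_eq_of_eq {f g : ℂ[X] → M} (hf : f ∈ polyFun M) (hg : g ∈ polyFun M)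
    (h : ∀ c : ℂ, f (C c) = g (C c)) : f = g := by
  obtain ⟨v, rfl⟩ := hf
  obtain ⟨w, rfl⟩ := hg
  rw [← sub_eq_zero, ← map_sub]
  have : v - w = 0 := by
    ext n
    refine (Submodule.mem_bot ℂ).1 (coeff_mem_of_polyEval_mem ⊥ (v - w) (fun c => ?_) n)
    rw [map_sub, Pi.sub_apply, h c, sub_self]
    exact Submodule.zero_mem _
  rw [this, map_zero]

theorem polyEval_injective : Function.Injective (polyEval (M := M)) := by
  refine (injective_iff_map_eq_zero _).2 fun v hv => ?_
  ext n
  refine (Submodule.mem_bot ℂ).1 (coeff_mem_of_polyEval_mem ⊥ v (fun c => ?_) n)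
  rw [hv]
  exact Submodule.zero_mem _

theorem polyFun_induction {P : (ℂ[X] → M) → Prop} (zero : P 0)
    (add : ∀ f g, P f → P g → P (f + g))
    (monomial : ∀ (n : ℕ) (x : M), P fun r => r ^ n • x)
    {f : ℂ[X] → M} (hf : f ∈ polyFun M) : P f := by
  obtain ⟨v, rfl⟩ := hf
  induction v using Finsupp.induction_linear with
  | zero => simpa using zero
  | add v w hv hw => rw [map_add]; exact add _ _ hv hw
  | single n x =>
    have : polyEval (Finsupp.single n x) = fun r : ℂ[X] => r ^ n • x := by ext r; simp
    rw [this]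
    exact monomial n x

theorem smul_mem_polyFun (q : ℂ[X]) {f : ℂ[X] → M} (hf : f ∈ polyFun M) :
    (fun r => q • f r) ∈ polyFun M := by
  refine polyFun_induction (P := fun f => (fun r => q • f r) ∈ polyFun M)
    ?_ (fun f g hf hg => ?_) (fun n x => ?_) hf
  · simpa only [Pi.zero_def, smul_zero] using (polyFun M).zero_mem
  · simpa only [Pi.add_def, smul_add] using (polyFun M).add_mem hf hg
  · simpa only [smul_comm q] using monomial_mem_polyFun n (q • x)

theorem var_pow_smul_mem_polyFun (k : ℕ) {f : ℂ[X] → M} (hf : f ∈ polyFun M) :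
    (fun r => r ^ k • f r) ∈ polyFun M := by
  refine polyFun_induction (P := fun f => (fun r => r ^ k • f r) ∈ polyFun M)
    ?_ (fun f g hf hg => ?_) (fun n x => ?_) hf
  · simpa only [Pi.zero_def, smul_zero] using (polyFun M).zero_mem
  · simpa only [Pi.add_def, smul_add] using (polyFun M).add_mem hf hg
  · simpa only [smul_smul, ← pow_add] using monomial_mem_polyFun (k + n) x

theorem var_smul_mem_polyFun {f : ℂ[X] → M} (hf : f ∈ polyFun M) :
    (fun r => r • f r) ∈ polyFun M := by
  simpa using var_pow_smul_mem_polyFun 1 hf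

theorem comp_sub_mem_polyFun (q : ℂ[X]) {f : ℂ[X] → M} (hf : f ∈ polyFun M) :
    (fun r => f (q - r)) ∈ polyFun M := by
  refine polyFun_induction (P := fun f => (fun r => f (q - r)) ∈ polyFun M)
    ?_ (fun f g hf hg => ?_) (fun n x => ?_) hf
  · simpa only [Pi.zero_def, smul_zero] using (polyFun M).zero_mem
  · simpa only [Pi.add_def] using (polyFun M).add_mem hf hg
  · induction n with
    | zero => simpa using monomial_mem_polyFun 0 x
    | succ n ih =>
      have := (polyFun M).sub_mem (smul_mem_polyFun q ih) (var_smul_mem_polyFun ih)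
      convert this using 1
      ext r
      simp only [Pi.sub_apply]
      rw [pow_succ', mul_smul, sub_smul]

variable {N : Type*} [AddCommGroup N] [Module ℂ N] [Module ℂ[X] N] [IsScalarTower ℂ ℂ[X] N]

theorem tmul_mem_polyFun {f : ℂ[X] → M} {g : ℂ[X] → N} (hf : f ∈ polyFun M)
    (hg : g ∈ polyFun N) : (fun r => f r ⊗ₜ[ℂ[X]] g r) ∈ polyFun (M ⊗[ℂ[X]] N) := by
  refine polyFun_induction
    (P := fun f => (fun r => f r ⊗ₜ[ℂ[X]] g r) ∈ polyFun (M ⊗[ℂ[X]] N))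
    ?_ (fun f g hf hg => ?_) (fun n x => ?_) hf
  · simpa only [Pi.zero_def, TensorProduct.zero_tmul] using (polyFun (M ⊗[ℂ[X]] N)).zero_mem
  · simpa only [Pi.add_def, TensorProduct.add_tmul] using (polyFun (M ⊗[ℂ[X]] N)).add_mem hf hg
  · refine polyFun_induction
      (P := fun g => (fun r => (r ^ n • x) ⊗ₜ[ℂ[X]] g r) ∈ polyFun (M ⊗[ℂ[X]] N))
      ?_ (fun f g hf hg => ?_) (fun k y => ?_) hg
    · simpa only [Pi.zero_def, TensorProduct.tmul_zero] using (polyFun (M ⊗[ℂ[X]] N)).zero_mem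
    · simpa only [Pi.add_def, TensorProduct.tmul_add] using (polyFun (M ⊗[ℂ[X]] N)).add_mem hf hg
    · convert monomial_mem_polyFun (n + k) (x ⊗ₜ[ℂ[X]] y) using 1
      ext r
      rw [TensorProduct.tmul_smul, ← TensorProduct.smul_tmul', smul_smul, add_comm, pow_add]

end PolyFun

section Ev

namespace ConformalProduct

/-- The coefficients of `a ∘_λ b` as a finitely supported family. -/
def coeffs (p : ConformalProduct L) (a b : L) : ℕ →₀ L :=
  Finsupp.ofSupportFinite (fun n => p.coeff n a b) <| by
    obtain ⟨N, hN⟩ := p.coeff_finite a b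
    refine (Set.finite_lt_nat N).subset fun n hn => ?_
    by_contra h
    exact hn (hN n (not_lt.1 h))

@[simp]
theorem coeffs_apply {V : Type*} [AddCommGroup V] [Module ℂ V] (p : ConformalProduct V) (a b : V) (n : ℕ) :
    p.coeffs a b n = p.coeff n a b := rfl

/-- The value `∑ rⁿ • a_(n) b` of a `λ`-product at a variable `r ∈ ℂ[∂]` acting on the result. -/
def ev (p : ConformalProduct L) (r : ℂ[X]) : L →ₗ[ℂ] L →ₗ[ℂ] L :=
  LinearMap.mk₂ ℂ (fun a b => polyEval (p.coeffs a b) r)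
    (fun a a' b => by
      rw [← Pi.add_apply, ← map_add]; exact congrArg (polyEval · r) (Finsupp.ext fun n => by simp))
    (fun c a b => by
      rw [← Pi.smul_apply, ← map_smul]; exact congrArg (polyEval · r) (Finsupp.ext fun n => by simp))
    (fun a b b' => by
      rw [← Pi.add_apply, ← map_add]; exact congrArg (polyEval · r) (Finsupp.ext fun n => by simp))
    (fun c a b => by
      rw [← Pi.smul_apply, ← map_smul]; exact congrArg (polyEval · r) (Finsupp.ext fun n => by simp))

theorem ev_eq_polyEval (p : ConformalProduct L) (r : ℂ[X]) (a b : L) :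
    p.ev r a b = polyEval (p.coeffs a b) r := rfl

theorem ev_eq_finsum (p : ConformalProduct L) (r : ℂ[X]) (a b : L) :
    p.ev r a b = ∑ᶠ n : ℕ, r ^ n • p.coeff n a b := by
  rw [ev_eq_polyEval, polyEval_apply, Finsupp.sum]
  symm
  refine finsum_eq_sum_of_support_subset _ fun n hn => ?_
  rw [Finset.mem_coe, Finsupp.mem_support_iff, coeffs_apply]
  rintro h
  exact hn (by simp [h])

theorem mul_eq_ev (p : ConformalProduct L) (lam : ℂ) (a b : L) :
    p.mul lam a b = p.ev (C lam) a b := by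
  rw [ev_eq_finsum, mul]
  exact finsum_congr fun n => by rw [← C_pow, C_smul_eq]

theorem cmul_eq_ev (p : ConformalProduct L) (lam : ℂ) (a b : L) :
    p.cmul lam a b = p.ev (-(X + C lam)) a b := by
  rw [ev_eq_finsum, cmul]

theorem ev_mem_polyFun (p : ConformalProduct L) (a b : L) :
    (fun r => p.ev r a b) ∈ polyFun L := polyEval_mem _

/-- The `λ`-product with prescribed polynomial values `r ↦ B a b r`. -/
def ofEval (B : L →ₗ[ℂ] L →ₗ[ℂ] (ℂ[X] → L)) : ConformalProduct L where
  coeff n := B.compr₂ (Finsupp.lapply n ∘ₗ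
    (LinearMap.exists_leftInverse_of_injective (polyEval (M := L))
      (LinearMap.ker_eq_bot.2 polyEval_injective)).choose)
  coeff_finite a b := by
    set g := (LinearMap.exists_leftInverse_of_injective (polyEval (M := L))
      (LinearMap.ker_eq_bot.2 polyEval_injective)).choose
    obtain ⟨N, hN⟩ := (g (B a b)).support.exists_nat_subset_range
    refine ⟨N, fun n hn => ?_⟩
    change g (B a b) n = 0
    refine Finsupp.notMem_support_iff.1 fun h => ?_
    have := Finset.mem_range.1 (hN h)
    omega

theorem ev_ofEval (B : L →ₗ[ℂ] L →ₗ[ℂ] (ℂ[X] → L)) (r : ℂ[X]) (a b : L)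
    (hB : B a b ∈ polyFun L) : (ofEval B).ev r a b = B a b r := by
  obtain ⟨v, hv⟩ := hB
  rw [ev_eq_polyEval, ← hv]
  refine congrArg (polyEval · r) (Finsupp.ext fun n => ?_)
  have hg := (LinearMap.exists_leftInverse_of_injective (polyEval (M := L))
      (LinearMap.ker_eq_bot.2 polyEval_injective)).choose_spec
  change (LinearMap.exists_leftInverse_of_injective (polyEval (M := L))
      (LinearMap.ker_eq_bot.2 polyEval_injective)).choose (B a b) n = v n
  rw [← hv]
  exact congrArg (fun w : ℕ →₀ L => w n) (LinearMap.congr_fun hg v)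

/-- The sum of two `λ`-products. -/
def sum (p q : ConformalProduct L) : ConformalProduct L where
  coeff n := p.coeff n + q.coeff n
  coeff_finite a b := by
    obtain ⟨N, hN⟩ := p.coeff_finite a b
    obtain ⟨K, hK⟩ := q.coeff_finite a b
    refine ⟨max N K, fun n hn => ?_⟩
    simp [hN n (le_of_max_le_left hn), hK n (le_of_max_le_right hn)]

theorem ev_sum (p q : ConformalProduct L) (r : ℂ[X]) :
    (p.sum q).ev r = p.ev r + q.ev r := by
  ext a b
  simp only [LinearMap.add_apply, ev_eq_polyEval]
  rw [← Pi.add_apply, ← map_add]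
  exact congrArg (polyEval · r) (Finsupp.ext fun n => rfl)

end ConformalProduct

namespace IsLambdaProduct

variable {S : SuperModule L} {p : ConformalProduct L} (h : IsLambdaProduct S p)
include h

theorem ev_X_left (r : ℂ[X]) (a b : L) :
    p.ev r ((X : ℂ[X]) • a) b = -(r • p.ev r a b) := by
  have := polyFun_eq_of_eq (p.ev_mem_polyFun ((X : ℂ[X]) • a) b)
    ((polyFun L).neg_mem (var_smul_mem_polyFun (p.ev_mem_polyFun a b))) fun c => by
      simp only [Pi.neg_apply]
      rw [← p.mul_eq_ev, ← p.mul_eq_ev, h.sesq_left, C_smul_eq, neg_smul]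
  exact congrFun this r

theorem ev_X_right (r : ℂ[X]) (a b : L) :
    p.ev r a ((X : ℂ[X]) • b) = (X + r) • p.ev r a b := by
  have := polyFun_eq_of_eq (p.ev_mem_polyFun a ((X : ℂ[X]) • b))
    ((polyFun L).add_mem (smul_mem_polyFun X (p.ev_mem_polyFun a b))
      (var_smul_mem_polyFun (p.ev_mem_polyFun a b))) fun c => by
      simp only [Pi.add_apply]
      rw [← p.mul_eq_ev, ← p.mul_eq_ev, h.sesq_right, C_smul_eq]
  rw [add_smul]
  exact congrFun this r

theorem ev_smul_left (r q : ℂ[X]) (a b : L) :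
    p.ev r (q • a) b = q.comp (-r) • p.ev r a b := by
  induction q using Polynomial.induction_on generalizing a with
  | C c => simp [C_smul_eq]
  | add q q' hq hq' => simp [add_smul, hq, hq']
  | monomial n c hn =>
    rw [pow_succ, ← mul_assoc, mul_smul, hn, h.ev_X_left, mul_comp (C c * X ^ n), X_comp,
      mul_smul, neg_smul]

theorem ev_smul_right (r q : ℂ[X]) (a b : L) :
    p.ev r a (q • b) = q.comp (X + r) • p.ev r a b := by
  induction q using Polynomial.induction_on generalizing b with
  | C c => simp [C_smul_eq]
  | add q q' hq hq' => simp [add_smul, hq, hq']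
  | monomial n c hn =>
    rw [pow_succ, ← mul_assoc, mul_smul, hn, h.ev_X_right, mul_comp (C c * X ^ n), X_comp,
      mul_smul]

theorem ev_polyEval_left (r t : ℂ[X]) (v : ℕ →₀ L) (b : L) :
    p.ev r (polyEval v t) b = v.sum fun n x => t.comp (-r) ^ n • p.ev r x b := by
  rw [polyEval_apply, map_finsuppSum, Finsupp.sum, LinearMap.sum_apply]
  exact Finset.sum_congr rfl fun n _ => by rw [h.ev_smul_left, pow_comp]

theorem ev_polyEval_right (r t : ℂ[X]) (a : L) (v : ℕ →₀ L) :
    p.ev r a (polyEval v t) = v.sum fun n x => t.comp (X + r) ^ n • p.ev r a x := by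
  rw [polyEval_apply, map_finsuppSum]
  exact Finsupp.sum_congr fun n _ => by rw [h.ev_smul_right, pow_comp]

end IsLambdaProduct

end Ev

theorem sgn_comm (i j : ZMod 2) : sgn i j = sgn j i := by
  rw [sgn, sgn, mul_comm]

theorem sgn_mul_self (i j : ZMod 2) : sgn i j * sgn i j = 1 := by
  rw [sgn, ← mul_pow]
  norm_num

theorem sgn_add_left (i j k : ZMod 2) : sgn (i + j) k = sgn i k * sgn j k := by
  have h : (-1 : ℂ) ^ (i + j).val = (-1) ^ i.val * (-1) ^ j.val := by
    rw [← pow_add, ZMod.val_add, ← neg_one_pow_eq_pow_mod_two]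
  simp only [sgn, pow_mul, h, mul_pow]

theorem sgn_add_right (i j k : ZMod 2) : sgn i (j + k) = sgn i j * sgn i k := by
  rw [sgn_comm, sgn_add_left, sgn_comm j, sgn_comm k]

theorem sgn_smul_smul {V : Type*} [AddCommGroup V] [Module ℂ V] (i j : ZMod 2) (x : V) :
    sgn i j • sgn i j • x = x := by
  rw [smul_smul, sgn_mul_self, one_smul]

section Identities

variable {S : SuperModule L} {m br p q : ConformalProduct L}

namespace IsLambdaProduct

theorem ev_mem (h : IsLambdaProduct S p) {i j : ZMod 2} {a b : L} (ha : a ∈ S.grade i)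
    (hb : b ∈ S.grade j) (c : ℂ) : p.ev (C c) a b ∈ S.grade (i + j) := by
  rw [p.ev_eq_polyEval, polyEval_apply]
  refine Submodule.sum_mem _ fun n _ => ?_
  simp only [← C_pow, C_smul_eq]
  exact Submodule.smul_mem _ _ (h.even i j a b ha hb n)

theorem ev_ev_left (h : IsLambdaProduct S q) (lam mu : ℂ) (x y z : L) :
    q.ev (C (lam + mu)) (p.ev (-(X + C lam)) x y) z =
      q.ev (C (lam + mu)) (p.ev (C mu) x y) z := by
  rw [p.ev_eq_polyEval, h.ev_polyEval_left, p.ev_eq_polyEval, h.ev_polyEval_left]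
  have : (-(X + C lam) : ℂ[X]).comp (-C (lam + mu)) = (C mu).comp (-C (lam + mu)) := by
    simp
  rw [this]

theorem ev_ev_right (h : IsLambdaProduct S q) (lam mu : ℂ) (x y z : L) :
    q.ev (C mu) z (p.ev (-(X + C lam)) x y) =
      (p.coeffs x y).sum fun n w => (-(X + C (lam + mu))) ^ n • q.ev (C mu) z w := by
  rw [p.ev_eq_polyEval, h.ev_polyEval_right]
  have : (-(X + C lam) : ℂ[X]).comp (X + C mu) = -(X + C (lam + mu)) := by
    simp only [neg_comp, add_comp, X_comp, C_comp, C_add]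
    ring
  rw [this]

end IsLambdaProduct

theorem finsuppSum_mem_polyFun (f : L →ₗ[ℂ] L) (v : ℕ →₀ L) :
    (fun r : ℂ[X] => v.sum fun n w => r ^ n • f w) ∈ polyFun L := by
  have : (fun r : ℂ[X] => v.sum fun n w => r ^ n • f w) =
      v.sum fun n w => fun r : ℂ[X] => r ^ n • f w := by
    ext r
    rw [Finsupp.sum, Finsupp.sum, Finset.sum_apply]
  rw [this]
  exact Submodule.sum_mem _ fun n _ => monomial_mem_polyFun n _

theorem finsuppSum_C_pow_smul (f : L →ₗ[ℂ] L) (p : ConformalProduct L) (c : ℂ) (x y : L) :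
    ((p.coeffs x y).sum fun n w => (C c : ℂ[X]) ^ n • f w) = f (p.ev (C c) x y) := by
  rw [p.ev_eq_polyEval, polyEval_apply, map_finsuppSum]
  exact Finset.sum_congr rfl fun n _ => by
    simp only [← C_pow, C_smul_eq, map_smul]

theorem IsCommAssoc.comm_ev (h : IsCommAssoc S m) {i j : ZMod 2} {a b : L}
    (ha : a ∈ S.grade i) (hb : b ∈ S.grade j) (lam : ℂ) :
    m.ev (C lam) a b = sgn i j • m.ev (-(X + C lam)) b a := by
  rw [← m.mul_eq_ev, ← m.cmul_eq_ev, h.comm i j a b ha hb]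

theorem IsCommAssoc.assoc_ev (h : IsCommAssoc S m) (lam mu : ℂ) (a b c : L) :
    m.ev (C lam) a (m.ev (C mu) b c) = m.ev (C (lam + mu)) (m.ev (C lam) a b) c := by
  simp only [← m.mul_eq_ev, h.assoc]

theorem IsCommAssoc.ev_comm_left (h : IsCommAssoc S m) (hq : IsLambdaProduct S q)
    {i j : ZMod 2} {a b : L} (ha : a ∈ S.grade i) (hb : b ∈ S.grade j) (c : L) (lam mu : ℂ) :
    q.ev (C (lam + mu)) (m.ev (C lam) a b) c =
      sgn i j • q.ev (C (lam + mu)) (m.ev (C mu) b a) c := by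
  rw [h.comm_ev ha hb, map_smul, LinearMap.smul_apply, hq.ev_ev_left]

theorem IsCommAssoc.left_comm_ev (h : IsCommAssoc S m)
    {i j : ZMod 2} {a b : L} (ha : a ∈ S.grade i) (hb : b ∈ S.grade j) (c : L) (lam mu : ℂ) :
    m.ev (C mu) b (m.ev (C lam) a c) =
      sgn i j • m.ev (C (lam + mu)) (m.ev (C lam) a b) c := by
  rw [h.assoc_ev, h.ev_comm_left h.toIsLambdaProduct ha hb, sgn_smul_smul, add_comm]

theorem IsLie.skew_ev (h : IsLie S br) {i j : ZMod 2} {a b : L}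
    (ha : a ∈ S.grade i) (hb : b ∈ S.grade j) (lam : ℂ) :
    br.ev (C lam) a b = -(sgn i j • br.ev (-(X + C lam)) b a) := by
  rw [← br.mul_eq_ev, ← br.cmul_eq_ev, h.skew i j a b ha hb]

theorem IsLie.jacobi_ev (h : IsLie S br) {i j : ZMod 2} {a b : L}
    (ha : a ∈ S.grade i) (hb : b ∈ S.grade j) (c : L) (lam mu : ℂ) :
    br.ev (C lam) a (br.ev (C mu) b c) = br.ev (C (lam + mu)) (br.ev (C lam) a b) c +
      sgn i j • br.ev (C mu) b (br.ev (C lam) a c) := by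
  simp only [← br.mul_eq_ev]
  exact h.jacobi i j a b ha hb c lam mu

namespace IsTPCSA

variable (h : IsTPCSA S m br)
include h

theorem leibniz_ev {i j : ZMod 2} {a b : L}
    (ha : a ∈ S.grade i) (hb : b ∈ S.grade j) (c : L) (lam mu : ℂ) :
    (2 : ℂ) • m.ev (C lam) a (br.ev (C mu) b c) =
      br.ev (C (lam + mu)) (m.ev (C lam) a b) c +
        sgn i j • br.ev (C mu) b (m.ev (C lam) a c) := by
  simp only [← br.mul_eq_ev, ← m.mul_eq_ev]
  exact h.transposedLeibniz i j a b ha hb c lam mu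

theorem leibniz_ev_swap {i j : ZMod 2} {a b : L}
    (ha : a ∈ S.grade i) (hb : b ∈ S.grade j) (c : L) (lam mu : ℂ) :
    (2 : ℂ) • m.ev (C mu) b (br.ev (C lam) a c) =
      sgn i j • (br.ev (C (lam + mu)) (m.ev (C lam) a b) c +
        br.ev (C lam) a (m.ev (C mu) b c)) := by
  rw [h.leibniz_ev hb ha, h.commAssoc.ev_comm_left h.lie.toIsLambdaProduct ha hb, smul_add,
    sgn_smul_smul, sgn_comm j i, add_comm mu lam]

/-- The transposed Leibniz rule with the product on the right, obtained from the polynomial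
identity in `ν` satisfied by `c ∘_ν [a_λ b]` upon substituting `ν = -∂ - λ - μ`. -/
theorem leibniz_ev_right {i j k : ZMod 2} {a b c : L}
    (ha : a ∈ S.grade i) (hb : b ∈ S.grade j) (hc : c ∈ S.grade k) (lam mu : ℂ) :
    (2 : ℂ) • m.ev (C (lam + mu)) (br.ev (C lam) a b) c =
      br.ev (C lam) a (m.ev (C mu) b c) - sgn i j • br.ev (C mu) b (m.ev (C lam) a c) := by
  have key : (fun r => (2 : ℂ) • m.ev r c (br.ev (C lam) a b)) =
      fun r => -(sgn (k + i) j • ((m.coeffs c a).sum fun n w =>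
          r ^ n • br.ev (-(X + C lam) - r) b w)) +
        sgn k i • ((m.coeffs c b).sum fun n w => r ^ n • br.ev (C lam) a w) := by
    refine polyFun_eq_of_eq ((polyFun L).smul_mem _ (m.ev_mem_polyFun c _))
      ((polyFun L).add_mem ((polyFun L).neg_mem ((polyFun L).smul_mem _ ?_))
        ((polyFun L).smul_mem _ (finsuppSum_mem_polyFun _ _))) fun nu => ?_
    · have : (fun r : ℂ[X] => (m.coeffs c a).sum fun n w =>
          r ^ n • br.ev (-(X + C lam) - r) b w) = (m.coeffs c a).sum fun n w =>
          fun r : ℂ[X] => r ^ n • br.ev (-(X + C lam) - r) b w := by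
        ext r
        rw [Finsupp.sum, Finsupp.sum, Finset.sum_apply]
      rw [this]
      exact Submodule.sum_mem _ fun n _ => var_pow_smul_mem_polyFun n
        (comp_sub_mem_polyFun _ (br.ev_mem_polyFun b _))
    · have hX : (-(X + C lam) - C nu : ℂ[X]) = -(X + C (nu + lam)) := by
        rw [C_add]
        ring
      simp only [finsuppSum_C_pow_smul]
      rw [h.leibniz_ev hc ha, h.lie.skew_ev (h.commAssoc.ev_mem hc ha nu) hb, hX]
  have hr := congrFun key (-(X + C (lam + mu)))
  have hX : (-(X + C lam) - -(X + C (lam + mu)) : ℂ[X]) = C mu := by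
    rw [C_add]
    ring
  simp only [hX] at hr
  have hA := h.lie.ev_ev_right (p := m) lam mu c a b
  have hB := h.lie.ev_ev_right (p := m) mu lam c b a
  rw [add_comm mu lam] at hB
  rw [← hA, ← hB] at hr
  rw [h.commAssoc.comm_ev (h.lie.ev_mem ha hb lam) hc, smul_comm, hr,
    h.commAssoc.comm_ev hb hc, h.commAssoc.comm_ev ha hc, map_smul, map_smul]
  simp only [sgn_add_left, sgn_comm k]
  generalize br.ev (C mu) b (m.ev (-(X + C lam)) c a) = A
  generalize br.ev (C lam) a (m.ev (-(X + C mu)) c b) = B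
  linear_combination (norm := module) (sgn j k * sgn_mul_self i k) • B -
    (sgn i k * sgn i j * sgn_mul_self j k) • A

end IsTPCSA

end Identities

theorem zmod_two_eq_or : ∀ i j : ZMod 2, j = i ∨ j = i + 1 := by decide

theorem zmod_two_univ (i : ZMod 2) : (Set.univ : Set (ZMod 2)) = {i, i + 1} := by
  ext j
  simpa using zmod_two_eq_or i j

namespace SuperModule

section Grading

variable {V : Type*} [AddCommGroup V] [Module ℂ V] [Module ℂ[X] V] (S : SuperModule V)

theorem isCompl_grade (i : ZMod 2) : IsCompl (S.grade i) (S.grade (i + 1)) := by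
  refine (DirectSum.isInternal_submodule_iff_isCompl S.grade (by simp)
    (zmod_two_univ i)).1 S.isInternal

theorem span_homogeneous : Submodule.span ℂ {a : V | ∃ i, a ∈ S.grade i} = ⊤ := by
  refine eq_top_iff.2 fun a _ => ?_
  obtain ⟨x, y, hx, hy, rfl⟩ :=
    Submodule.codisjoint_iff_exists_add_eq.1 (S.isCompl_grade 0).codisjoint a
  exact Submodule.add_mem _ (Submodule.subset_span ⟨_, hx⟩) (Submodule.subset_span ⟨_, hy⟩)

end Grading

variable (S : SuperModule L)

/-- The homogeneous component of degree `i` as a `ℂ[∂]`-submodule. -/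
def gradeX (i : ZMod 2) : Submodule ℂ[X] L where
  __ := (S.grade i).toAddSubmonoid
  smul_mem' q a ha := by
    change q • a ∈ S.grade i
    replace ha : a ∈ S.grade i := ha
    induction q using Polynomial.induction_on generalizing a with
    | C c => rw [C_smul_eq]; exact Submodule.smul_mem _ _ ha
    | add q q' hq hq' => rw [add_smul]; exact Submodule.add_mem _ (hq a ha) (hq' a ha)
    | monomial n c hn =>
      rw [pow_succ, ← mul_assoc, mul_smul]
      exact hn _ (S.X_smul_mem i a ha)

theorem isCompl_gradeX (i : ZMod 2) : IsCompl (S.gradeX i) (S.gradeX (i + 1)) := by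
  refine ⟨Submodule.disjoint_def.2 fun a h₀ h₁ =>
    Submodule.disjoint_def.1 (S.isCompl_grade i).disjoint a h₀ h₁, ?_⟩
  refine Submodule.codisjoint_iff_exists_add_eq.2 fun a => ?_
  obtain ⟨x, y, hx, hy, hxy⟩ :=
    Submodule.codisjoint_iff_exists_add_eq.1 (S.isCompl_grade i).codisjoint a
  exact ⟨x, y, hx, hy, hxy⟩

/-- The projection onto the homogeneous component of degree `i`. -/
def proj (i : ZMod 2) : L →ₗ[ℂ[X]] L :=
  Submodule.projection (S.gradeX i) (S.gradeX (i + 1)) (S.isCompl_gradeX i)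

theorem proj_of_mem {i : ZMod 2} {a : L} (ha : a ∈ S.grade i) (j : ZMod 2) :
    S.proj j a = if j = i then a else 0 := by
  split_ifs with h
  · subst h
    exact (Submodule.projection_eq_self_iff (S.isCompl_gradeX j) a).2 ha
  · have hi := (zmod_two_eq_or j i).resolve_left (Ne.symm h)
    subst hi
    exact (Submodule.projection_apply_eq_zero_iff (S.isCompl_gradeX j)).2 ha

/-- The operator acting on the homogeneous component of degree `i` by `(-1)^{i·j}`. -/
def twist (j : ZMod 2) : L →ₗ[ℂ[X]] L :=
  ∑ i, (C (sgn i j) : ℂ[X]) • S.proj i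

theorem twist_of_mem {i : ZMod 2} {a : L} (ha : a ∈ S.grade i) (j : ZMod 2) :
    S.twist j a = sgn i j • a := by
  simp [twist, S.proj_of_mem ha, C_smul_eq]

end SuperModule

section Tensor

variable {L₁ : Type*} [AddCommGroup L₁] [Module ℂ L₁] [Module ℂ[X] L₁] [IsScalarTower ℂ ℂ[X] L₁]
  {L₂ : Type*} [AddCommGroup L₂] [Module ℂ L₂] [Module ℂ[X] L₂] [IsScalarTower ℂ ℂ[X] L₂]

/-- A `ℂ`-bilinear map balanced with respect to `∂` descends to the tensor product
over `ℂ[∂]`. -/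
def liftBalanced {N : Type*} [AddCommGroup N] [Module ℂ N] (f : L₁ →ₗ[ℂ] L₂ →ₗ[ℂ] N)
    (hf : ∀ a b, f ((X : ℂ[X]) • a) b = f a ((X : ℂ[X]) • b)) :
    L₁ ⊗[ℂ[X]] L₂ →ₗ[ℂ] N where
  __ := TensorProduct.liftAddHom
    (AddMonoidHom.mk' (fun a => (f a).toAddMonoidHom) fun a b => by ext; simp) <| by
      intro q a b
      change f (q • a) b = f a (q • b)
      induction q using Polynomial.induction_on generalizing a b with
      | C c => simp [C_smul_eq]
      | add q q' hq hq' => simp [add_smul, hq, hq']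
      | monomial n c hn =>
        rw [pow_succ, ← mul_assoc, mul_smul, hn, hf, smul_smul, X_mul]
  map_smul' c t := by
    simp only [ZeroHom.toFun_eq_coe, AddMonoidHom.toZeroHom_coe, RingHom.id_apply]
    induction t using TensorProduct.induction_on with
    | zero => simp
    | tmul a b =>
      rw [TensorProduct.smul_tmul']
      simp [TensorProduct.liftAddHom_tmul]
    | add x y hx hy => rw [smul_add, map_add, hx, hy, map_add, smul_add]

@[simp]
theorem liftBalanced_tmul {N : Type*} [AddCommGroup N] [Module ℂ N] (f : L₁ →ₗ[ℂ] L₂ →ₗ[ℂ] N)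
    (hf : ∀ a b, f ((X : ℂ[X]) • a) b = f a ((X : ℂ[X]) • b)) (a : L₁) (b : L₂) :
    liftBalanced f hf (a ⊗ₜ b) = f a b := rfl

/-- Homogeneous pure tensors of degree `k`. -/
def homTensors (S₁ : SuperModule L₁) (S₂ : SuperModule L₂) (k : ZMod 2) :
    Set (L₁ ⊗[ℂ[X]] L₂) :=
  {t | ∃ (i j : ZMod 2) (a : L₁) (b : L₂),
    i + j = k ∧ a ∈ S₁.grade i ∧ b ∈ S₂.grade j ∧ t = a ⊗ₜ[ℂ[X]] b}

variable (S₁ : SuperModule L₁) (S₂ : SuperModule L₂)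

theorem span_iUnion_homTensors :
    Submodule.span ℂ (⋃ k, homTensors S₁ S₂ k) = ⊤ := by
  refine (Submodule.eq_top_iff').2 fun t => ?_
  induction t using TensorProduct.induction_on with
  | zero => exact Submodule.zero_mem _
  | add x y hx hy => exact Submodule.add_mem _ hx hy
  | tmul a b =>
    have ha : a ∈ Submodule.span ℂ {a : L₁ | ∃ i, a ∈ S₁.grade i} := by
      rw [S₁.span_homogeneous]; trivial
    have hb : b ∈ Submodule.span ℂ {b : L₂ | ∃ i, b ∈ S₂.grade i} := by
      rw [S₂.span_homogeneous]; trivial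
    induction ha using Submodule.span_induction with
    | zero => rw [TensorProduct.zero_tmul]; exact Submodule.zero_mem _
    | add x y _ _ hx hy => rw [TensorProduct.add_tmul]; exact Submodule.add_mem _ hx hy
    | smul c x _ hx => rw [← TensorProduct.smul_tmul']; exact Submodule.smul_mem _ _ hx
    | mem a ha =>
      induction hb using Submodule.span_induction with
      | zero => rw [TensorProduct.tmul_zero]; exact Submodule.zero_mem _
      | add x y _ _ hx hy => rw [TensorProduct.tmul_add]; exact Submodule.add_mem _ hx hy
      | smul c x _ hx => rw [TensorProduct.tmul_smul]; exact Submodule.smul_mem _ _ hx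
      | mem b hb =>
        obtain ⟨i, hi⟩ := ha
        obtain ⟨j, hj⟩ := hb
        exact Submodule.subset_span (Set.mem_iUnion.2 ⟨i + j, i, j, a, b, rfl, hi, hj, rfl⟩)

theorem map_twist_of_mem {k : ZMod 2} {t : L₁ ⊗[ℂ[X]] L₂}
    (ht : t ∈ Submodule.span ℂ (homTensors S₁ S₂ k)) :
    TensorProduct.map (S₁.twist 1) (S₂.twist 1) t = sgn k 1 • t := by
  induction ht using Submodule.span_induction with
  | zero => simp
  | add x y _ _ hx hy => rw [map_add, hx, hy, smul_add]
  | smul c x _ hx =>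
    rw [← C_smul_eq, map_smul, hx, C_smul_eq, C_smul_eq, smul_comm]
  | mem t ht =>
    obtain ⟨i, j, a, b, rfl, ha, hb, rfl⟩ := ht
    rw [TensorProduct.map_tmul, S₁.twist_of_mem ha, S₂.twist_of_mem hb, sgn_add_left,
      ← TensorProduct.smul_tmul', TensorProduct.tmul_smul, smul_smul]

/-- The tensor product over `ℂ[∂]` of two `ℤ₂`-graded `ℂ[∂]`-modules. -/
def SuperModule.tensor : SuperModule (L₁ ⊗[ℂ[X]] L₂) where
  grade k := Submodule.span ℂ (homTensors S₁ S₂ k)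
  isInternal := by
    refine (DirectSum.isInternal_submodule_iff_isCompl _ (i := (0 : ZMod 2)) (j := 1)
      (by decide) (zmod_two_univ 0)).2 ⟨Submodule.disjoint_def.2 ?_, ?_⟩
    · intro t h₀ h₁
      have h := (map_twist_of_mem S₁ S₂ h₀).symm.trans (map_twist_of_mem S₁ S₂ h₁)
      have h' : (2 : ℂ) • t = 0 := by
        have e₀ : sgn 0 1 = 1 := by simp [sgn]
        have e₁ : sgn 1 1 = -1 := by simp [sgn, ZMod.val_one]
        rw [e₀, e₁] at h
        linear_combination (norm := module) h
      exact (smul_eq_zero.1 h').resolve_left two_ne_zero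
    · rw [codisjoint_iff, ← Submodule.span_union, ← span_iUnion_homTensors S₁ S₂]
      congr 1
      ext t
      simp only [Set.mem_union, Set.mem_iUnion]
      exact (Fin.exists_fin_two (p := fun k : ZMod 2 => t ∈ homTensors S₁ S₂ k)).symm
  X_smul_mem k t ht := by
    induction ht using Submodule.span_induction with
    | zero => rw [smul_zero]; exact Submodule.zero_mem _
    | add x y _ _ hx hy => rw [smul_add]; exact Submodule.add_mem _ hx hy
    | smul c x _ hx => rw [smul_comm]; exact Submodule.smul_mem _ _ hx
    | mem t ht =>
      obtain ⟨i, j, a, b, hk, ha, hb, rfl⟩ := ht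
      exact Submodule.subset_span
        ⟨i, j, _, b, hk, S₁.X_smul_mem i a ha, hb, TensorProduct.smul_tmul' _ _ _⟩

theorem tmul_mem_tensor {i j : ZMod 2} {a : L₁} {b : L₂} (ha : a ∈ S₁.grade i)
    (hb : b ∈ S₂.grade j) : a ⊗ₜ[ℂ[X]] b ∈ (S₁.tensor S₂).grade (i + j) :=
  Submodule.subset_span ⟨i, j, a, b, rfl, ha, hb, rfl⟩

variable {S₁ S₂} {p₁ : ConformalProduct L₁} {p₂ : ConformalProduct L₂}

/-- The polynomial values of the tensor product of two `λ`-products against a fixed pure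
tensor on the left. -/
def tensorEvalRight (h₁ : IsLambdaProduct S₁ p₁) (h₂ : IsLambdaProduct S₂ p₂)
    (a₁ : L₁) (a₂ : L₂) : L₁ ⊗[ℂ[X]] L₂ →ₗ[ℂ] (ℂ[X] → L₁ ⊗[ℂ[X]] L₂) :=
  liftBalanced
    (LinearMap.mk₂ ℂ
      (fun b₁ b₂ r => ∑ j, p₁.ev r a₁ (S₁.proj j b₁) ⊗ₜ[ℂ[X]] p₂.ev r (S₂.twist j a₂) b₂)
      (fun b b' c => by
        ext r; simp [TensorProduct.add_tmul, Finset.sum_add_distrib])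
      (fun t b c => by
        ext r
        simp only [Pi.smul_apply, Finset.smul_sum, ← C_smul_eq t b, map_smul]
        simp only [C_smul_eq, map_smul, TensorProduct.smul_tmul'])
      (fun b c c' => by
        ext r; simp [TensorProduct.tmul_add, Finset.sum_add_distrib])
      (fun t b c => by
        ext r; simp [Finset.smul_sum]))
    (fun b₁ b₂ => by
      ext r
      simp [h₁.ev_X_right, h₂.ev_X_right, TensorProduct.smul_tmul])

/-- The polynomial values of the tensor product of two `λ`-products. -/
def tensorEval (h₁ : IsLambdaProduct S₁ p₁) (h₂ : IsLambdaProduct S₂ p₂) :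
    L₁ ⊗[ℂ[X]] L₂ →ₗ[ℂ] L₁ ⊗[ℂ[X]] L₂ →ₗ[ℂ] (ℂ[X] → L₁ ⊗[ℂ[X]] L₂) :=
  liftBalanced
    (LinearMap.mk₂ ℂ (tensorEvalRight h₁ h₂)
      (fun a a' c => by
        ext t r
        induction t using TensorProduct.induction_on with
        | zero => simp
        | add x y hx hy => simp only [map_add, Pi.add_apply, hx, hy]
        | tmul b₁ b₂ =>
          simp [tensorEvalRight, TensorProduct.add_tmul, Finset.sum_add_distrib])
      (fun s a c => by
        ext t r
        induction t using TensorProduct.induction_on with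
        | zero => simp
        | add x y hx hy => simp only [map_add, Pi.add_apply, hx, hy]
        | tmul b₁ b₂ =>
          simp [tensorEvalRight, TensorProduct.smul_tmul', Finset.smul_sum])
      (fun a c c' => by
        ext t r
        induction t using TensorProduct.induction_on with
        | zero => simp
        | add x y hx hy => simp only [map_add, Pi.add_apply, hx, hy]
        | tmul b₁ b₂ =>
          simp [tensorEvalRight, TensorProduct.tmul_add, Finset.sum_add_distrib])
      (fun s a c => by
        ext t r
        induction t using TensorProduct.induction_on with
        | zero => simp
        | add x y hx hy => simp only [map_add, Pi.add_apply, hx, hy]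
        | tmul b₁ b₂ =>
          simp only [tensorEvalRight, ← C_smul_eq s c, map_smul]
          simp [C_smul_eq, Finset.smul_sum]))
    (fun a₁ a₂ => by
      ext t r
      induction t using TensorProduct.induction_on with
      | zero => simp
      | add x y hx hy => simp only [map_add, Pi.add_apply, hx, hy]
      | tmul b₁ b₂ =>
        simp [tensorEvalRight, h₁.ev_X_left, h₂.ev_X_left, TensorProduct.neg_tmul,
          TensorProduct.tmul_neg, TensorProduct.smul_tmul])

theorem tensorEval_tmul (h₁ : IsLambdaProduct S₁ p₁) (h₂ : IsLambdaProduct S₂ p₂)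
    (a₁ b₁ : L₁) (a₂ b₂ : L₂) : tensorEval h₁ h₂ (a₁ ⊗ₜ a₂) (b₁ ⊗ₜ b₂) = fun r =>
      ∑ j, p₁.ev r a₁ (S₁.proj j b₁) ⊗ₜ[ℂ[X]] p₂.ev r (S₂.twist j a₂) b₂ := rfl

theorem tensorEval_mem (h₁ : IsLambdaProduct S₁ p₁) (h₂ : IsLambdaProduct S₂ p₂)
    (s t : L₁ ⊗[ℂ[X]] L₂) : tensorEval h₁ h₂ s t ∈ polyFun (L₁ ⊗[ℂ[X]] L₂) := by
  induction s using TensorProduct.induction_on with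
  | zero => rw [map_zero]; exact Submodule.zero_mem _
  | add x y hx hy => rw [map_add]; exact Submodule.add_mem _ hx hy
  | tmul a₁ a₂ =>
    induction t using TensorProduct.induction_on with
    | zero => rw [map_zero]; exact Submodule.zero_mem _
    | add x y hx hy => rw [map_add]; exact Submodule.add_mem _ hx hy
    | tmul b₁ b₂ =>
      rw [tensorEval_tmul]
      have : (fun r => ∑ j, p₁.ev r a₁ (S₁.proj j b₁) ⊗ₜ[ℂ[X]] p₂.ev r (S₂.twist j a₂) b₂) =
          ∑ j, fun r => p₁.ev r a₁ (S₁.proj j b₁) ⊗ₜ[ℂ[X]] p₂.ev r (S₂.twist j a₂) b₂ := by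
        ext r
        rw [Finset.sum_apply]
      rw [this]
      exact Submodule.sum_mem _ fun j _ =>
        tmul_mem_polyFun (p₁.ev_mem_polyFun _ _) (p₂.ev_mem_polyFun _ _)

/-- The tensor product of two `λ`-products. -/
def tensorProd (h₁ : IsLambdaProduct S₁ p₁) (h₂ : IsLambdaProduct S₂ p₂) :
    ConformalProduct (L₁ ⊗[ℂ[X]] L₂) :=
  ConformalProduct.ofEval (tensorEval h₁ h₂)

theorem ev_tensorProd (h₁ : IsLambdaProduct S₁ p₁) (h₂ : IsLambdaProduct S₂ p₂) (r : ℂ[X])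
    {i j : ZMod 2} (a₁ : L₁) {b₁ : L₁} {a₂ : L₂} (b₂ : L₂)
    (ha : a₂ ∈ S₂.grade i) (hb : b₁ ∈ S₁.grade j) :
    (tensorProd h₁ h₂).ev r (a₁ ⊗ₜ a₂) (b₁ ⊗ₜ b₂) =
      sgn i j • (p₁.ev r a₁ b₁ ⊗ₜ[ℂ[X]] p₂.ev r a₂ b₂) := by
  rw [tensorProd, ConformalProduct.ev_ofEval _ _ _ _ (tensorEval_mem h₁ h₂ _ _), tensorEval_tmul]
  refine (Finset.sum_eq_single j (fun k _ hk => ?_) (by simp)).trans ?_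
  · rw [S₁.proj_of_mem hb, if_neg hk, map_zero, TensorProduct.zero_tmul]
  · rw [S₁.proj_of_mem hb, if_pos rfl, S₂.twist_of_mem ha, map_smul, LinearMap.smul_apply,
      TensorProduct.tmul_smul]


theorem IsLambdaProduct.sum {S : SuperModule L} {p q : ConformalProduct L}
    (hp : IsLambdaProduct S p) (hq : IsLambdaProduct S q) : IsLambdaProduct S (p.sum q) where
  even i j a b ha hb n := Submodule.add_mem _ (hp.even i j a b ha hb n) (hq.even i j a b ha hb n)
  sesq_left lam a b := by
    simp only [ConformalProduct.mul_eq_ev, ConformalProduct.ev_sum, LinearMap.add_apply, smul_add]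
    simp only [← ConformalProduct.mul_eq_ev, hp.sesq_left, hq.sesq_left]
  sesq_right lam a b := by
    simp only [ConformalProduct.mul_eq_ev, ConformalProduct.ev_sum, LinearMap.add_apply, smul_add]
    simp only [← ConformalProduct.mul_eq_ev, hp.sesq_right, hq.sesq_right]
    abel

section Ext

variable {K V W : Type*} [CommSemiring K] [AddCommMonoid V] [Module K V] [AddCommMonoid W]
  [Module K W] {s t u : Set V} {x y z : V}

theorem bilin_eq_on_span (F G : V →ₗ[K] V →ₗ[K] W) (h : ∀ x ∈ s, ∀ y ∈ t, F x y = G x y)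
    (hx : x ∈ Submodule.span K s) (hy : y ∈ Submodule.span K t) : F x y = G x y := by
  have h' : Set.EqOn (F.flip y) (G.flip y) s := fun x hx =>
    LinearMap.eqOn_span (f := F x) (g := G x) (h x hx) hy
  exact LinearMap.eqOn_span h' hx

theorem trilin_eq_on_span (F G : V →ₗ[K] V →ₗ[K] V →ₗ[K] W)
    (h : ∀ x ∈ s, ∀ y ∈ t, ∀ z ∈ u, F x y z = G x y z)
    (hx : x ∈ Submodule.span K s) (hy : y ∈ Submodule.span K t) (hz : z ∈ Submodule.span K u) :
    F x y z = G x y z := by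
  have h' := fun x hx y hy => LinearMap.eqOn_span (f := F x y) (g := G x y) (h x hx y hy) hz
  exact bilin_eq_on_span (F.compr₂ (LinearMap.applyₗ z)) (G.compr₂ (LinearMap.applyₗ z)) h' hx hy

theorem comm_on_span (f g : V →ₗ[K] V →ₗ[K] W) (d : K)
    (h : ∀ x ∈ s, ∀ y ∈ t, f x y = d • g y x)
    (hx : x ∈ Submodule.span K s) (hy : y ∈ Submodule.span K t) : f x y = d • g y x :=
  bilin_eq_on_span f (d • g.flip) h hx hy

/-- The trilinear map `(a, b, c) ↦ f a (g b c)`. -/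
def compRight (f g : V →ₗ[K] V →ₗ[K] V) : V →ₗ[K] V →ₗ[K] V →ₗ[K] V :=
  LinearMap.mk₂ K (fun a b => f a ∘ₗ g b) (fun _ _ _ => by ext; simp) (fun _ _ _ => by ext; simp)
    (fun _ _ _ => by ext; simp) (fun _ _ _ => by ext; simp)

theorem assoc_on_span (f f' g g' : V →ₗ[K] V →ₗ[K] V)
    (h : ∀ x ∈ s, ∀ y ∈ t, ∀ z ∈ u, f x (f' y z) = g (g' x y) z)
    (hx : x ∈ Submodule.span K s) (hy : y ∈ Submodule.span K t) (hz : z ∈ Submodule.span K u) :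
    f x (f' y z) = g (g' x y) z :=
  trilin_eq_on_span (compRight f f') (g'.compr₂ g) h hx hy hz

theorem leibniz_on_span (f f' g g' k k' : V →ₗ[K] V →ₗ[K] V) (c d : K)
    (h : ∀ x ∈ s, ∀ y ∈ t, ∀ z ∈ u, c • f x (f' y z) = g (g' x y) z + d • k y (k' x z))
    (hx : x ∈ Submodule.span K s) (hy : y ∈ Submodule.span K t) (hz : z ∈ Submodule.span K u) :
    c • f x (f' y z) = g (g' x y) z + d • k y (k' x z) :=
  trilin_eq_on_span (c • compRight f f') (g'.compr₂ g + d • (compRight k k').flip) h hx hy hz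

theorem sesq_left_on_span (f : V →ₗ[K] V →ₗ[K] W) (D : V →ₗ[K] V) (c : K)
    (h : ∀ x ∈ s, ∀ y ∈ t, f (D x) y = c • f x y)
    (hx : x ∈ Submodule.span K s) (hy : y ∈ Submodule.span K t) : f (D x) y = c • f x y :=
  bilin_eq_on_span (f ∘ₗ D) (c • f) h hx hy

theorem sesq_right_on_span (f : V →ₗ[K] V →ₗ[K] W) (D : V →ₗ[K] V) (E : W →ₗ[K] W) (c : K)
    (h : ∀ x ∈ s, ∀ y ∈ t, f x (D y) = E (f x y) + c • f x y)
    (hx : x ∈ Submodule.span K s) (hy : y ∈ Submodule.span K t) :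
    f x (D y) = E (f x y) + c • f x y :=
  bilin_eq_on_span (f.compl₂ D) (f.compr₂ E + c • f) h hx hy

end Ext

theorem mem_span_iUnion_homTensors (t : L₁ ⊗[ℂ[X]] L₂) :
    t ∈ Submodule.span ℂ (⋃ k, homTensors S₁ S₂ k) := by
  rw [span_iUnion_homTensors]
  trivial

theorem isLambdaProduct_tensorProd (h₁ : IsLambdaProduct S₁ p₁) (h₂ : IsLambdaProduct S₂ p₂) :
    IsLambdaProduct (S₁.tensor S₂) (tensorProd h₁ h₂) where
  even i j s t hs ht n := by
    refine coeff_mem_of_polyEval_mem _ ((tensorProd h₁ h₂).coeffs s t) (fun c => ?_) n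
    rw [← ConformalProduct.ev_eq_polyEval]
    induction hs using Submodule.span_induction with
    | zero => rw [map_zero]; exact Submodule.zero_mem _
    | add x y _ _ hx hy => rw [map_add]; exact Submodule.add_mem _ hx hy
    | smul c x _ hx => rw [map_smul]; exact Submodule.smul_mem _ _ hx
    | mem s hs =>
      induction ht using Submodule.span_induction with
      | zero => rw [map_zero]; exact Submodule.zero_mem _
      | add x y _ _ hx hy => rw [map_add]; exact Submodule.add_mem _ hx hy
      | smul c x _ hx => rw [map_smul]; exact Submodule.smul_mem _ _ hx
      | mem t ht =>
        obtain ⟨i₁, i₂, a₁, a₂, rfl, ha₁, ha₂, rfl⟩ := hs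
        obtain ⟨j₁, j₂, b₁, b₂, rfl, hb₁, hb₂, rfl⟩ := ht
        rw [ev_tensorProd h₁ h₂ _ _ _ ha₂ hb₁, add_add_add_comm]
        exact Submodule.smul_mem _ _
          (tmul_mem_tensor _ _ (h₁.ev_mem ha₁ hb₁ c) (h₂.ev_mem ha₂ hb₂ c))
  sesq_left lam s t := by
    rw [ConformalProduct.mul_eq_ev, ConformalProduct.mul_eq_ev]
    refine sesq_left_on_span (V := L₁ ⊗[ℂ[X]] L₂) ((tensorProd h₁ h₂).ev (C lam))
      (Algebra.lsmul ℂ ℂ (L₁ ⊗[ℂ[X]] L₂) (X : ℂ[X])) (-lam) ?_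
      (mem_span_iUnion_homTensors (S₁ := S₁) (S₂ := S₂) s)
      (mem_span_iUnion_homTensors (S₁ := S₁) (S₂ := S₂) t)
    simp only [Set.mem_iUnion]
    rintro _ ⟨_, i₁, i₂, a₁, a₂, rfl, ha₁, ha₂, rfl⟩ _ ⟨_, j₁, j₂, b₁, b₂, rfl, hb₁, hb₂, rfl⟩
    simp only [Algebra.lsmul_coe]
    rw [TensorProduct.smul_tmul', ev_tensorProd h₁ h₂ _ _ _ ha₂ hb₁,
      ev_tensorProd h₁ h₂ _ _ _ ha₂ hb₁, h₁.ev_X_left, TensorProduct.neg_tmul, C_smul_eq,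
      ← TensorProduct.smul_tmul', neg_smul, smul_neg, smul_comm]
  sesq_right lam s t := by
    rw [ConformalProduct.mul_eq_ev, ConformalProduct.mul_eq_ev]
    refine sesq_right_on_span (V := L₁ ⊗[ℂ[X]] L₂) ((tensorProd h₁ h₂).ev (C lam))
      (Algebra.lsmul ℂ ℂ (L₁ ⊗[ℂ[X]] L₂) (X : ℂ[X]))
      (Algebra.lsmul ℂ ℂ (L₁ ⊗[ℂ[X]] L₂) (X : ℂ[X])) lam ?_
      (mem_span_iUnion_homTensors (S₁ := S₁) (S₂ := S₂) s)
      (mem_span_iUnion_homTensors (S₁ := S₁) (S₂ := S₂) t)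
    simp only [Set.mem_iUnion]
    rintro _ ⟨_, i₁, i₂, a₁, a₂, rfl, ha₁, ha₂, rfl⟩ _ ⟨_, j₁, j₂, b₁, b₂, rfl, hb₁, hb₂, rfl⟩
    simp only [Algebra.lsmul_coe]
    rw [← TensorProduct.tmul_smul,
      ev_tensorProd h₁ h₂ _ _ _ ha₂ hb₁, ev_tensorProd h₁ h₂ _ _ _ ha₂ hb₁, h₂.ev_X_right,
      add_smul, C_smul_eq, TensorProduct.tmul_add, smul_add, smul_comm X, smul_comm lam,
      TensorProduct.tmul_smul, TensorProduct.tmul_smul]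

section Nested

variable {q₁ : ConformalProduct L₁} {q₂ : ConformalProduct L₂}
  {hp₁ : IsLambdaProduct S₁ p₁} {hp₂ : IsLambdaProduct S₂ p₂}
  {hq₁ : IsLambdaProduct S₁ q₁} {hq₂ : IsLambdaProduct S₂ q₂}
  {i₂ j₁ j₂ k₁ : ZMod 2} {b₁ c₁ : L₁} {a₂ b₂ : L₂}

theorem ev_ev_tensorProd_right (ha₂ : a₂ ∈ S₂.grade i₂) (hb₁ : b₁ ∈ S₁.grade j₁)
    (hb₂ : b₂ ∈ S₂.grade j₂) (hc₁ : c₁ ∈ S₁.grade k₁) (lam mu : ℂ) (a₁ : L₁) (c₂ : L₂) :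
    (tensorProd hp₁ hp₂).ev (C lam) (a₁ ⊗ₜ a₂)
        ((tensorProd hq₁ hq₂).ev (C mu) (b₁ ⊗ₜ b₂) (c₁ ⊗ₜ c₂)) =
      (sgn i₂ j₁ * sgn i₂ k₁ * sgn j₂ k₁) •
        (p₁.ev (C lam) a₁ (q₁.ev (C mu) b₁ c₁) ⊗ₜ[ℂ[X]]
          p₂.ev (C lam) a₂ (q₂.ev (C mu) b₂ c₂)) := by
  rw [ev_tensorProd hq₁ hq₂ _ _ _ hb₂ hc₁, map_smul,
    ev_tensorProd hp₁ hp₂ _ _ _ ha₂ (hq₁.ev_mem hb₁ hc₁ mu), sgn_add_right, smul_smul,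
    mul_comm (sgn j₂ k₁)]

theorem ev_ev_tensorProd_left (ha₂ : a₂ ∈ S₂.grade i₂) (hb₁ : b₁ ∈ S₁.grade j₁)
    (hb₂ : b₂ ∈ S₂.grade j₂) (hc₁ : c₁ ∈ S₁.grade k₁) (lam mu : ℂ) (a₁ : L₁) (c₂ : L₂) :
    (tensorProd hp₁ hp₂).ev (C (lam + mu))
        ((tensorProd hq₁ hq₂).ev (C lam) (a₁ ⊗ₜ a₂) (b₁ ⊗ₜ b₂)) (c₁ ⊗ₜ c₂) =
      (sgn i₂ j₁ * sgn i₂ k₁ * sgn j₂ k₁) •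
        (p₁.ev (C (lam + mu)) (q₁.ev (C lam) a₁ b₁) c₁ ⊗ₜ[ℂ[X]]
          p₂.ev (C (lam + mu)) (q₂.ev (C lam) a₂ b₂) c₂) := by
  rw [ev_tensorProd hq₁ hq₂ _ _ _ ha₂ hb₁, map_smul, LinearMap.smul_apply,
    ev_tensorProd hp₁ hp₂ _ _ _ (hq₂.ev_mem ha₂ hb₂ lam) hc₁, sgn_add_left, smul_smul,
    mul_assoc]

end Nested

theorem sgn_eq_one_or (i j : ZMod 2) : sgn i j = 1 ∨ sgn i j = -1 :=
  neg_one_pow_eq_or ℂ _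

theorem sgn_add_add_mul (i₁ i₂ j₁ j₂ k₁ : ZMod 2) :
    sgn (i₁ + i₂) (j₁ + j₂) * (sgn j₂ i₁ * sgn j₂ k₁ * sgn i₂ k₁) =
      (sgn i₂ j₁ * sgn i₂ k₁ * sgn j₂ k₁) * (sgn i₁ j₁ * sgn i₂ j₂) := by
  simp only [sgn_add_left, sgn_add_right, sgn_comm j₂ i₁]
  linear_combination sgn i₂ j₁ * sgn i₂ k₁ * sgn j₂ k₁ * sgn i₁ j₁ * sgn i₂ j₂ *
    sgn_mul_self i₁ j₂

variable {m₁ br₁ : ConformalProduct L₁} {m₂ br₂ : ConformalProduct L₂}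

theorem isCommAssoc_tensorProd (h₁ : IsCommAssoc S₁ m₁) (h₂ : IsCommAssoc S₂ m₂) :
    IsCommAssoc (S₁.tensor S₂) (tensorProd h₁.toIsLambdaProduct h₂.toIsLambdaProduct) where
  toIsLambdaProduct := isLambdaProduct_tensorProd _ _
  comm i j s t hs ht lam := by
    rw [ConformalProduct.mul_eq_ev, ConformalProduct.cmul_eq_ev]
    refine comm_on_span (V := L₁ ⊗[ℂ[X]] L₂) _ _ _ ?_ hs ht
    rintro _ ⟨i₁, i₂, a₁, a₂, rfl, ha₁, ha₂, rfl⟩ _ ⟨j₁, j₂, b₁, b₂, rfl, hb₁, hb₂, rfl⟩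
    rw [ev_tensorProd _ _ _ _ _ ha₂ hb₁, ev_tensorProd _ _ _ _ _ hb₂ ha₁, h₁.comm_ev ha₁ hb₁,
      h₂.comm_ev ha₂ hb₂, ← TensorProduct.smul_tmul', TensorProduct.tmul_smul]
    simp only [sgn_add_left, sgn_add_right, sgn_comm j₂ i₁]
    generalize m₁.ev _ b₁ a₁ ⊗ₜ[ℂ[X]] m₂.ev _ b₂ a₂ = A
    linear_combination (norm := module)
      (-(sgn i₂ j₁ * sgn i₁ j₁ * sgn i₂ j₂) * sgn_mul_self i₁ j₂) • A
  assoc lam mu s t u := by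
    simp only [ConformalProduct.mul_eq_ev]
    refine assoc_on_span (V := L₁ ⊗[ℂ[X]] L₂) _ _ _ _ ?_
      (mem_span_iUnion_homTensors (S₁ := S₁) (S₂ := S₂) s)
      (mem_span_iUnion_homTensors (S₁ := S₁) (S₂ := S₂) t)
      (mem_span_iUnion_homTensors (S₁ := S₁) (S₂ := S₂) u)
    simp only [Set.mem_iUnion]
    rintro _ ⟨_, i₁, i₂, a₁, a₂, rfl, ha₁, ha₂, rfl⟩ _ ⟨_, j₁, j₂, b₁, b₂, rfl, hb₁, hb₂, rfl⟩
      _ ⟨_, k₁, k₂, c₁, c₂, rfl, hc₁, hc₂, rfl⟩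
    rw [ev_ev_tensorProd_right ha₂ hb₁ hb₂ hc₁, ev_ev_tensorProd_left ha₂ hb₁ hb₂ hc₁,
      h₁.assoc_ev, h₂.assoc_ev]

/-- The bracket on the tensor product of two transposed Poisson conformal superalgebras. -/
def tensorBracket (h₁ : IsTPCSA S₁ m₁ br₁) (h₂ : IsTPCSA S₂ m₂ br₂) :
    ConformalProduct (L₁ ⊗[ℂ[X]] L₂) :=
  (tensorProd h₁.lie.toIsLambdaProduct h₂.commAssoc.toIsLambdaProduct).sum
    (tensorProd h₁.commAssoc.toIsLambdaProduct h₂.lie.toIsLambdaProduct)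

theorem ev_tensorBracket (h₁ : IsTPCSA S₁ m₁ br₁) (h₂ : IsTPCSA S₂ m₂ br₂) (r : ℂ[X])
    {i j : ZMod 2} (a₁ : L₁) {b₁ : L₁} {a₂ : L₂} (b₂ : L₂)
    (ha : a₂ ∈ S₂.grade i) (hb : b₁ ∈ S₁.grade j) :
    (tensorBracket h₁ h₂).ev r (a₁ ⊗ₜ a₂) (b₁ ⊗ₜ b₂) =
      sgn i j • (br₁.ev r a₁ b₁ ⊗ₜ[ℂ[X]] m₂.ev r a₂ b₂ +
        m₁.ev r a₁ b₁ ⊗ₜ[ℂ[X]] br₂.ev r a₂ b₂) := by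
  rw [tensorBracket, ConformalProduct.ev_sum, LinearMap.add_apply, LinearMap.add_apply,
    ev_tensorProd _ _ _ _ _ ha hb, ev_tensorProd _ _ _ _ _ ha hb, smul_add]

theorem isLie_tensorBracket (h₁ : IsTPCSA S₁ m₁ br₁) (h₂ : IsTPCSA S₂ m₂ br₂) :
    IsLie (S₁.tensor S₂) (tensorBracket h₁ h₂) where
  toIsLambdaProduct := (isLambdaProduct_tensorProd _ _).sum (isLambdaProduct_tensorProd _ _)
  skew i j s t hs ht lam := by
    rw [ConformalProduct.mul_eq_ev, ConformalProduct.cmul_eq_ev]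
    rw [← neg_smul]
    refine comm_on_span (V := L₁ ⊗[ℂ[X]] L₂) _ _ _ ?_ hs ht
    rintro _ ⟨i₁, i₂, a₁, a₂, rfl, ha₁, ha₂, rfl⟩ _ ⟨j₁, j₂, b₁, b₂, rfl, hb₁, hb₂, rfl⟩
    rw [ev_tensorBracket h₁ h₂ _ _ _ ha₂ hb₁,
      ev_tensorBracket h₁ h₂ _ _ _ hb₂ ha₁, h₁.commAssoc.comm_ev ha₁ hb₁,
      h₂.commAssoc.comm_ev ha₂ hb₂, h₁.lie.skew_ev ha₁ hb₁, h₂.lie.skew_ev ha₂ hb₂]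
    simp only [TensorProduct.neg_tmul, TensorProduct.tmul_neg, ← TensorProduct.smul_tmul',
      TensorProduct.tmul_smul, sgn_add_left, sgn_add_right, sgn_comm j₂ i₁]
    generalize br₁.ev _ b₁ a₁ ⊗ₜ[ℂ[X]] m₂.ev _ b₂ a₂ = A
    generalize m₁.ev _ b₁ a₁ ⊗ₜ[ℂ[X]] br₂.ev _ b₂ a₂ = B
    linear_combination (norm := module)
      (sgn i₂ j₁ * sgn i₁ j₁ * sgn i₂ j₂ * sgn_mul_self i₁ j₂) • (A + B)
  jacobi i j s t hs ht u lam mu := by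
    simp only [ConformalProduct.mul_eq_ev]
    rw [← one_smul ℂ ((tensorBracket h₁ h₂).ev (C lam) s _)]
    refine leibniz_on_span (V := L₁ ⊗[ℂ[X]] L₂) _ _ _ _ _ _ _ _ ?_ hs ht
      (mem_span_iUnion_homTensors (S₁ := S₁) (S₂ := S₂) u)
    simp only [Set.mem_iUnion]
    rintro _ ⟨i₁, i₂, a₁, a₂, rfl, ha₁, ha₂, rfl⟩ _ ⟨j₁, j₂, b₁, b₂, rfl, hb₁, hb₂, rfl⟩
      _ ⟨_, k₁, k₂, c₁, c₂, rfl, hc₁, hc₂, rfl⟩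
    rw [one_smul]
    simp only [tensorBracket, ConformalProduct.ev_sum, LinearMap.add_apply, LinearMap.map_add,
      ev_ev_tensorProd_right ha₂ hb₁ hb₂ hc₁, ev_ev_tensorProd_left ha₂ hb₁ hb₂ hc₁,
      ev_ev_tensorProd_right hb₂ ha₁ ha₂ hc₁]
    simp only [smul_add, smul_smul, sgn_add_add_mul]
    have h2 : (2 : ℂ) ≠ 0 := two_ne_zero
    rw [h₁.lie.jacobi_ev ha₁ hb₁, h₂.lie.jacobi_ev ha₂ hb₂,
      h₁.commAssoc.left_comm_ev ha₁ hb₁, h₂.commAssoc.left_comm_ev ha₂ hb₂,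
      h₁.commAssoc.assoc_ev, h₂.commAssoc.assoc_ev,
      (eq_inv_smul_iff₀ h2).2 (h₁.leibniz_ev ha₁ hb₁ c₁ lam mu),
      (eq_inv_smul_iff₀ h2).2 (h₂.leibniz_ev ha₂ hb₂ c₂ lam mu),
      (eq_inv_smul_iff₀ h2).2 (h₁.leibniz_ev_swap ha₁ hb₁ c₁ lam mu),
      (eq_inv_smul_iff₀ h2).2 (h₂.leibniz_ev_swap ha₂ hb₂ c₂ lam mu),
      (eq_inv_smul_iff₀ h2).2 (h₁.leibniz_ev_right ha₁ hb₁ hc₁ lam mu),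
      (eq_inv_smul_iff₀ h2).2 (h₂.leibniz_ev_right ha₂ hb₂ hc₂ lam mu)]
    simp only [TensorProduct.add_tmul, TensorProduct.tmul_add, TensorProduct.sub_tmul,
      TensorProduct.tmul_sub, ← TensorProduct.smul_tmul', TensorProduct.tmul_smul]
    rcases sgn_eq_one_or i₁ j₁ with e₁ | e₁ <;> rcases sgn_eq_one_or i₂ j₂ with e₂ | e₂ <;>
      rw [e₁, e₂] <;> module

theorem isTPCSA_tensor (h₁ : IsTPCSA S₁ m₁ br₁) (h₂ : IsTPCSA S₂ m₂ br₂) :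
    IsTPCSA (S₁.tensor S₂)
      (tensorProd h₁.commAssoc.toIsLambdaProduct h₂.commAssoc.toIsLambdaProduct)
      (tensorBracket h₁ h₂) where
  commAssoc := isCommAssoc_tensorProd h₁.commAssoc h₂.commAssoc
  lie := isLie_tensorBracket h₁ h₂
  transposedLeibniz i j s t hs ht u lam mu := by
    simp only [ConformalProduct.mul_eq_ev]
    refine leibniz_on_span (V := L₁ ⊗[ℂ[X]] L₂) _ _ _ _ _ _ _ _ ?_ hs ht
      (mem_span_iUnion_homTensors (S₁ := S₁) (S₂ := S₂) u)
    simp only [Set.mem_iUnion]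
    rintro _ ⟨i₁, i₂, a₁, a₂, rfl, ha₁, ha₂, rfl⟩ _ ⟨j₁, j₂, b₁, b₂, rfl, hb₁, hb₂, rfl⟩
      _ ⟨_, k₁, k₂, c₁, c₂, rfl, hc₁, hc₂, rfl⟩
    simp only [tensorBracket, ConformalProduct.ev_sum, LinearMap.add_apply, LinearMap.map_add,
      ev_ev_tensorProd_right ha₂ hb₁ hb₂ hc₁, ev_ev_tensorProd_left ha₂ hb₁ hb₂ hc₁,
      ev_ev_tensorProd_right hb₂ ha₁ ha₂ hc₁]
    simp only [smul_add, smul_smul, sgn_add_add_mul]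
    have h2 : (2 : ℂ) ≠ 0 := two_ne_zero
    rw [h₁.commAssoc.left_comm_ev ha₁ hb₁, h₂.commAssoc.left_comm_ev ha₂ hb₂,
      h₁.commAssoc.assoc_ev, h₂.commAssoc.assoc_ev,
      (eq_inv_smul_iff₀ h2).2 (h₁.leibniz_ev ha₁ hb₁ c₁ lam mu),
      (eq_inv_smul_iff₀ h2).2 (h₂.leibniz_ev ha₂ hb₂ c₂ lam mu)]
    simp only [TensorProduct.add_tmul, TensorProduct.tmul_add,
      ← TensorProduct.smul_tmul', TensorProduct.tmul_smul]
    rcases sgn_eq_one_or i₁ j₁ with e₁ | e₁ <;> rcases sgn_eq_one_or i₂ j₂ with e₂ | e₂ <;>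
      rw [e₁, e₂] <;> module

end Tensor

/-- the tensor product over `ℂ[∂]` of two transposed Poisson conformal
superalgebras carries a natural transposed Poisson conformal superalgebra structure,
with grading spanned by tensor products of homogeneous elements, product
`(a₁ ⊗ a₂) ∘_λ (b₁ ⊗ b₂) = (-1)^{|a₂||b₁|} (a₁ ∘¹_λ b₁) ⊗ (a₂ ∘²_λ b₂)` and bracket
`[(a₁ ⊗ a₂)_λ (b₁ ⊗ b₂)] = (-1)^{|a₂||b₁|} ([a₁_λ b₁]¹ ⊗ (a₂ ∘²_λ b₂) + (a₁ ∘¹_λ b₁) ⊗ [a₂_λ b₂]²)`. -/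
theorem statement_7
    {L₁ : Type*} [AddCommGroup L₁] [Module ℂ L₁] [Module (Polynomial ℂ) L₁]
    [IsScalarTower ℂ (Polynomial ℂ) L₁]
    {L₂ : Type*} [AddCommGroup L₂] [Module ℂ L₂] [Module (Polynomial ℂ) L₂]
    [IsScalarTower ℂ (Polynomial ℂ) L₂]
    (S₁ : SuperModule L₁) (m₁ br₁ : ConformalProduct L₁) (h₁ : IsTPCSA S₁ m₁ br₁)
    (S₂ : SuperModule L₂) (m₂ br₂ : ConformalProduct L₂) (h₂ : IsTPCSA S₂ m₂ br₂) :
    ∃ (S : SuperModule (L₁ ⊗[Polynomial ℂ] L₂))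
      (m br : ConformalProduct (L₁ ⊗[Polynomial ℂ] L₂)),
      (∀ k : ZMod 2, S.grade k = Submodule.span ℂ
        {t : L₁ ⊗[Polynomial ℂ] L₂ | ∃ (i j : ZMod 2) (a : L₁) (b : L₂),
          i + j = k ∧ a ∈ S₁.grade i ∧ b ∈ S₂.grade j ∧ t = a ⊗ₜ[Polynomial ℂ] b}) ∧
      (∀ (i₂ j₁ : ZMod 2) (a₁ b₁ : L₁) (a₂ b₂ : L₂),
        a₂ ∈ S₂.grade i₂ → b₁ ∈ S₁.grade j₁ → ∀ lam : ℂ,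
          m.mul lam (a₁ ⊗ₜ[Polynomial ℂ] a₂) (b₁ ⊗ₜ[Polynomial ℂ] b₂) =
            sgn i₂ j₁ • (m₁.mul lam a₁ b₁ ⊗ₜ[Polynomial ℂ] m₂.mul lam a₂ b₂)) ∧
      (∀ (i₂ j₁ : ZMod 2) (a₁ b₁ : L₁) (a₂ b₂ : L₂),
        a₂ ∈ S₂.grade i₂ → b₁ ∈ S₁.grade j₁ → ∀ lam : ℂ,
          br.mul lam (a₁ ⊗ₜ[Polynomial ℂ] a₂) (b₁ ⊗ₜ[Polynomial ℂ] b₂) =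
            sgn i₂ j₁ • (br₁.mul lam a₁ b₁ ⊗ₜ[Polynomial ℂ] m₂.mul lam a₂ b₂
              + m₁.mul lam a₁ b₁ ⊗ₜ[Polynomial ℂ] br₂.mul lam a₂ b₂)) ∧
      IsTPCSA S m br := by
  refine ⟨S₁.tensor S₂,
    tensorProd h₁.commAssoc.toIsLambdaProduct h₂.commAssoc.toIsLambdaProduct,
    tensorBracket h₁ h₂, fun k => rfl, ?_, ?_, isTPCSA_tensor h₁ h₂⟩
  · intro i₂ j₁ a₁ b₁ a₂ b₂ ha hb lam
    simp only [ConformalProduct.mul_eq_ev]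
    exact ev_tensorProd _ _ _ _ _ ha hb
  · intro i₂ j₁ a₁ b₁ a₂ b₂ ha hb lam
    simp only [ConformalProduct.mul_eq_ev]
    exact ev_tensorBracket h₁ h₂ _ _ _ ha hb

end TPCSAFormal
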